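/- arXiv:2505.07092 — 2 statements merged into one kernel-verified Lean document; each statement's English description precedes it below -/
import Mathlib

section
/- Let p, q, s be distinct primes with p ≡ 5 (mod 8), s ≡ 3 (mod 8), q ≡ 7 (mod 8), and Legendre symbols (p/q) = (p/s) = (s/q) = −1. Then each of the products ε_{pq}·ε_{2pq}, ε_{ps}·ε_{2ps}, ε_{qs}·ε_{2qs}, ε_{pq}·ε_{ps}, and ε_{pq}·ε_{qs} is a square in L⁺ (viewing the fundamental units as real numbers and L⁺ as a subfield of ℝ). -/
open Real NumberField IntermediateField

noncomputable section

/-- `e : ℝ` is a unit greater than `1` of the ring of integers of the real quadratic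
field `ℚ(√d)`: it can be written as `(x + y√d)/2` with `x, y ≥ 1` integers satisfying
`x² - d·y² = ±4`. -/
def IsQuadUnit (d : ℕ) (e : ℝ) : Prop :=
  ∃ x y : ℤ, 1 ≤ x ∧ 1 ≤ y ∧
    (x ^ 2 - (d : ℤ) * y ^ 2 = 4 ∨ x ^ 2 - (d : ℤ) * y ^ 2 = -4) ∧
    2 * e = (x : ℝ) + (y : ℝ) * Real.sqrt d

/-- `e` is the fundamental unit of the real quadratic field `ℚ(√d)` (for `d > 1`
squarefree), i.e. the smallest unit `> 1` of its ring of integers. -/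
def IsFundamentalUnit (d : ℕ) (e : ℝ) : Prop :=
  IsQuadUnit d e ∧ ∀ e' : ℝ, IsQuadUnit d e' → e ≤ e'


/-- The totally real multiquadratic field `L⁺ = ℚ(√2, √(pq), √(ps))`, realized as a
subfield of `ℝ`. -/
def Lplus (p q s : ℕ) : IntermediateField ℚ ℝ :=
  adjoin ℚ {Real.sqrt 2, Real.sqrt (p * q), Real.sqrt (p * s)}

/-- If `d` is squarefree and `a² ∣ d y²`, then `a ∣ y`. -/
lemma dvd_of_sq_dvd_squarefree_mul_sq {d a y : ℕ} (hd : Squarefree d) (ha : 0 < a)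
    (h : a ^ 2 ∣ d * y ^ 2) : a ∣ y := by
  obtain ⟨g, a', y', hg, hcop, rfl, rfl⟩ := Nat.exists_coprime' (m := a) (n := y)
    (Nat.gcd_pos_of_pos_left _ ha)
  have h' : a' ^ 2 ∣ d * y' ^ 2 := by
    rw [mul_pow, mul_pow, ← mul_assoc] at h
    exact Nat.dvd_of_mul_dvd_mul_right (pow_pos hg 2) h
  have h'' : a' * a' ∣ d := by
    rw [← sq]
    exact (Nat.Coprime.pow 2 2 hcop).dvd_of_dvd_mul_right h'
  rw [Nat.isUnit_iff.1 (hd a' h''), one_mul]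
  exact dvd_mul_left _ _

/-- If `m` is squarefree, divides `k + 4`, and `m k = d y²`, then `m ∣ 4 d`. -/
lemma dvd_four_mul_of_squarefree {m k d y : ℕ} (hm : Squarefree m) (hk : m ∣ k + 4)
    (h : m * k = d * y ^ 2) : m ∣ 4 * d := by
  obtain ⟨g, m', y', hg, hcop, rfl, rfl⟩ := Nat.exists_coprime' (m := m) (n := y)
    (Nat.gcd_pos_of_pos_left _ hm.ne_zero.bot_lt)
  have hmg : Nat.Coprime m' g := Nat.coprime_of_squarefree_mul hm
  have h1 : m' * k = d * g * y' ^ 2 :=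
    Nat.eq_of_mul_eq_mul_right hg (by linear_combination h)
  have h2 : m' ∣ d := by
    have : m' ∣ d * g := (Nat.Coprime.pow_right 2 hcop).dvd_of_dvd_mul_right ⟨k, h1.symm⟩
    exact hmg.dvd_of_dvd_mul_right this
  have h3 : g ∣ k := hmg.symm.dvd_of_dvd_mul_left ⟨d * y' ^ 2, by rw [h1]; ring⟩
  have h4 : g ∣ 4 := (Nat.dvd_add_right h3).1 ((dvd_mul_left g m').trans hk)
  rw [mul_comm m']
  exact mul_dvd_mul h4 h2

/-- A squarefree divisor of `8 r t`, with `r`, `t` prime, is `1` or `2` times a divisor of `r t`. -/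
lemma squarefree_dvd_eight_mul {m r t : ℕ} (hr : r.Prime) (ht : t.Prime) (hm : Squarefree m)
    (h : m ∣ 8 * (r * t)) :
    ∃ u, (u = 1 ∨ u = 2) ∧ (m = u ∨ m = u * r ∨ m = u * t ∨ m = u * (r * t)) := by
  obtain ⟨u, v, hu, hv, rfl⟩ := (Nat.dvd_mul).1 h
  obtain ⟨a, b, ha, hb, rfl⟩ := (Nat.dvd_mul).1 hv
  refine ⟨u, ?_, ?_⟩
  · have hsq : Squarefree u := hm.of_mul_left
    have : u ≤ 8 := Nat.le_of_dvd (by norm_num) hu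
    have h4 : ¬ 4 ∣ u := fun h4 => by
      have := Nat.isUnit_iff.1 (hsq 2 h4)
      omega
    interval_cases u <;> simp_all
  · rcases (Nat.dvd_prime hr).1 ha with rfl | rfl <;>
      rcases (Nat.dvd_prime ht).1 hb with rfl | rfl <;> simp

/-- Let `d = r t` or `d = 2 r t` with `r ≠ t` odd primes, such that `2` and `-2` and `-4` are
not squares modulo `r t`.  Then the fundamental unit `e` of `ℚ(√d)` becomes a square in any field
containing `√2` and `√(r t)` after multiplication by `r`. -/
lemma exists_sq_eq_mul_fundamentalUnit {r t d : ℕ} (hr : r.Prime) (ht : t.Prime) (hrt : r ≠ t)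
    (hr2 : r ≠ 2) (ht2 : t ≠ 2) (hd : d = r * t ∨ d = 2 * r * t)
    (h2 : ∀ a : ℤ, ¬ ((r * t : ℕ) : ℤ) ∣ a ^ 2 - 2)
    (hneg2 : ∀ a : ℤ, ¬ ((r * t : ℕ) : ℤ) ∣ a ^ 2 + 2)
    (hneg4 : ∀ a : ℤ, ¬ ((r * t : ℕ) : ℤ) ∣ a ^ 2 + 4)
    (K : IntermediateField ℚ ℝ) (hK2 : √2 ∈ K) (hKrt : √(r * t) ∈ K)
    {e : ℝ} (he : IsFundamentalUnit d e) : ∃ ξ ∈ K, ξ ^ 2 = r * e := by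
  obtain ⟨⟨x, y, hx, hy, hxy, hexy⟩, hmin⟩ := he
  have hdvd : ((r * t : ℕ) : ℤ) ∣ d := by
    rcases hd with rfl | rfl
    · exact dvd_rfl
    · exact ⟨2, by push_cast; ring⟩
  have hr0 : (r : ℝ) ≠ 0 := by exact_mod_cast hr.ne_zero
  have ht0 : (t : ℝ) ≠ 0 := by exact_mod_cast ht.ne_zero
  have hKd : √(d : ℝ) ∈ K := by
    rcases hd with rfl | rfl
    · simpa using hKrt
    · have : √((2 * r * t : ℕ) : ℝ) = √2 * √(r * t) := by
        rw [← Real.sqrt_mul (by norm_num)]; push_cast; ring_nf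
      rw [this]
      exact K.mul_mem hK2 hKrt
  have hco : Nat.Coprime r t := (Nat.coprime_primes hr ht).2 hrt
  have hodd : Nat.Coprime 2 (r * t) := Nat.Coprime.mul_right
    ((Nat.coprime_primes Nat.prime_two hr).2 hr2.symm)
    ((Nat.coprime_primes Nat.prime_two ht).2 ht2.symm)
  have hoddZ : IsCoprime ((r * t : ℕ) : ℤ) 2 := by
    exact_mod_cast Nat.isCoprime_iff_coprime.2 hodd.symm
  have hsqf : Squarefree d := by
    have h1 : Squarefree (r * t) :=
      (Nat.squarefree_mul hco).2 ⟨hr.prime.squarefree, ht.prime.squarefree⟩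
    rcases hd with rfl | rfl
    · exact h1
    · rw [mul_assoc]
      exact (Nat.squarefree_mul hodd).2 ⟨Nat.prime_two.prime.squarefree, h1⟩
  have hd0 : 0 < d := hsqf.ne_zero.bot_lt
  have hxy : x ^ 2 - (d : ℤ) * y ^ 2 = 4 := by
    refine hxy.resolve_right fun h => hneg4 x ?_
    rw [show x ^ 2 + 4 = d * y ^ 2 by linear_combination h]
    exact hdvd.mul_right _
  have hdy : 0 < (d : ℤ) * y ^ 2 := by positivity
  have hx3 : 2 < x := by nlinarith
  -- `x = k + 2` with `k > 0` a natural number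
  obtain ⟨k, rfl⟩ : ∃ k : ℕ, x = k + 2 := ⟨(x - 2).toNat, by omega⟩
  obtain ⟨y, rfl⟩ : ∃ n : ℕ, y = n := ⟨y.toNat, by omega⟩
  have hk : (k + 4) * k = d * y ^ 2 := by
    zify; linear_combination hxy
  obtain ⟨m, a, hma, hm⟩ := Nat.sq_mul_squarefree (k + 4)
  have ha : 0 < a := Nat.pos_of_ne_zero fun h => by subst h; simp at hma
  obtain ⟨z, rfl⟩ : a ∣ y := dvd_of_sq_dvd_squarefree_mul_sq hsqf ha
    ⟨m * k, by rw [← hk, ← hma]; ring⟩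
  have hz : m * k = d * z ^ 2 := by
    refine Nat.eq_of_mul_eq_mul_left (pow_pos ha 2) ?_
    rw [← hma] at hk
    linear_combination hk
  have hmd : m ∣ 8 * (r * t) := by
    refine (dvd_four_mul_of_squarefree hm ⟨a ^ 2, by rw [← hma]; ring⟩ hz).trans ?_
    rcases hd with rfl | rfl
    · exact ⟨2, by ring⟩
    · exact ⟨1, by ring⟩
  have hz0 : 0 < z := by
    refine Nat.pos_of_ne_zero fun h => ?_
    subst h; simp at hy
  have hsd : √(d : ℝ) ^ 2 = d := Real.sq_sqrt (by positivity)
  have hmaR : (a : ℝ) ^ 2 * m = k + 4 := by exact_mod_cast hma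
  have hzR : (m : ℝ) * k = d * z ^ 2 := by exact_mod_cast hz
  have ha0 : (a : ℝ) ≠ 0 := by exact_mod_cast ha.ne'
  have heK : e ∈ K := by
    have : e = ((((k : ℤ) + 2 : ℤ) : ℝ) + (((a * z : ℕ) : ℤ) : ℝ) * √(d : ℝ)) / 2 := by
      rw [← hexy]; ring
    rw [this]
    exact K.div_mem (K.add_mem (intCast_mem K _) (K.mul_mem (intCast_mem K _) hKd))
      (ofNat_mem K 2)
  have hsq : (e + 1) ^ 2 = e * (a ^ 2 * m) := by
    have h4 : ((k : ℝ) + 2) ^ 2 - d * (a * z) ^ 2 = 4 := by exact_mod_cast hxy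
    rw [hmaR]
    push_cast at hexy
    have : e = ((k + 2) + a * z * √(d : ℝ)) / 2 := by rw [← hexy]; ring
    rw [this]
    linear_combination -h4 / 4 + (a * z) ^ 2 / 4 * hsd
  have hme : ∃ η ∈ K, η ^ 2 = m * e := by
    refine ⟨(e + 1) / a, K.div_mem (K.add_mem heK K.one_mem) (_root_.natCast_mem K a), ?_⟩
    rw [div_pow, hsq]
    field_simp
  have hs2 : √(2 : ℝ) ^ 2 = 2 := Real.sq_sqrt (by norm_num)
  have hsrt : √(r * t : ℝ) ^ 2 = r * t := Real.sq_sqrt (by positivity)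
  obtain ⟨u, hu, hmu⟩ := squarefree_dvd_eight_mul hr ht hm hmd
  have hudvd : ∀ v : ℕ, u * v ^ 2 = k → ¬ (r * t ∣ k + 4) := by
    rintro v rfl hv
    have hv' : ((r * t : ℕ) : ℤ) ∣ u * v ^ 2 + 4 := by exact_mod_cast hv
    rcases hu with rfl | rfl
    · exact hneg4 v (by simpa using hv')
    · refine hneg2 v (hoddZ.dvd_of_dvd_mul_left (y := 2) ?_)
      rwa [show (2 : ℤ) * ((v : ℤ) ^ 2 + 2) = ((2 : ℕ) : ℤ) * v ^ 2 + 4 by push_cast; ring]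
  -- absorbing a factor `u ∈ {1, 2}`
  have hue : ∀ c : ℕ, m = u * c → ∃ η ∈ K, η ^ 2 = c * e := by
    rintro c rfl
    obtain ⟨η, hη, hηe⟩ := hme
    rcases hu with rfl | rfl
    · exact ⟨η, hη, by simpa using hηe⟩
    · refine ⟨η / √2, K.div_mem hη hK2, ?_⟩
      rw [div_pow, hηe, hs2]
      push_cast; ring
  rcases hmu with h | h | h | h
  · exfalso
    subst h
    rcases hu with rfl | rfl
    · -- `e` is the square of a smaller unit
      have hsd1 : 1 ≤ √(d : ℝ) := Real.one_le_sqrt.2 (by exact_mod_cast hd0)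
      have hz1 : (1 : ℝ) ≤ z := by exact_mod_cast hz0
      have ha2 : (2 : ℝ) < a := by
        have : 2 < a := by nlinarith
        exact_mod_cast this
      have hle := hmin ((a + z * √(d : ℝ)) / 2) ⟨a, z, by exact_mod_cast ha,
        by exact_mod_cast hz0, Or.inl (by zify at hma hz; linear_combination hma + hz),
        by push_cast; ring⟩
      have hee : e = ((a + z * √(d : ℝ)) / 2) ^ 2 := by
        push_cast at hexy hmaR hzR
        linear_combination hexy / 2 - hmaR / 4 + hzR / 4 - z ^ 2 / 4 * hsd
      have hu1 : 1 < (a + z * √(d : ℝ)) / 2 := by nlinarith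
      rw [hee] at hle
      nlinarith
    · refine h2 a (hoddZ.dvd_of_dvd_mul_left (y := 2) ?_)
      have hk' : r * t ∣ 2 * k := hz ▸ (Int.natCast_dvd_natCast.1 hdvd).mul_right _
      have : ((r * t : ℕ) : ℤ) ∣ k :=
        Int.natCast_dvd_natCast.2 (hodd.symm.dvd_of_dvd_mul_left hk')
      rw [show (2 : ℤ) * ((a : ℤ) ^ 2 - 2) = k by zify at hma; linear_combination hma]
      exact this
  · exact hue r h
  · obtain ⟨η, hη, hηe⟩ := hue t h
    refine ⟨η * √(r * t) / t, K.div_mem (K.mul_mem hη hKrt) (_root_.natCast_mem K t), ?_⟩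
    rw [div_pow, mul_pow, hηe, hsrt]
    field_simp
  · exfalso
    have hrt0 : 0 < r * t := Nat.mul_pos hr.pos ht.pos
    have hdk : r * t ∣ k + 4 := by rw [← hma, h]; exact ⟨a ^ 2 * u, by ring⟩
    subst h
    rcases hu with rfl | rfl <;> rcases hd with rfl | rfl
    · exact hudvd z (Nat.eq_of_mul_eq_mul_left hrt0 (by linear_combination -hz)) hdk
    · have hkz : 2 * z ^ 2 = k := Nat.eq_of_mul_eq_mul_left hrt0 (by linear_combination -hz)
      subst hkz
      refine hneg2 z (hoddZ.dvd_of_dvd_mul_left (y := 2) ?_)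
      rw [show (2 : ℤ) * ((z : ℤ) ^ 2 + 2) = ((2 * z ^ 2 + 4 : ℕ) : ℤ) by push_cast; ring]
      exact Int.natCast_dvd_natCast.2 hdk
    · have hkz : 2 * k = z ^ 2 := Nat.eq_of_mul_eq_mul_left hrt0 (by linear_combination hz)
      obtain ⟨w, rfl⟩ : 2 ∣ z := Nat.prime_two.dvd_of_dvd_pow ⟨k, hkz.symm⟩
      exact hudvd w (by nlinarith) hdk
    · have hkz : z ^ 2 = k := Nat.eq_of_mul_eq_mul_left (Nat.mul_pos two_pos hrt0)
        (by linear_combination -hz)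
      subst hkz
      exact hneg4 z (by exact_mod_cast hdk)

lemma not_dvd_sq_sub_two {l : ℕ} (hl : l.Prime) (h : l % 8 = 3 ∨ l % 8 = 5) (a : ℤ) :
    ¬ (l : ℤ) ∣ a ^ 2 - 2 := by
  have : Fact l.Prime := ⟨hl⟩
  intro hd
  have h0 := (ZMod.intCast_zmod_eq_zero_iff_dvd _ l).2 hd
  have : IsSquare (2 : ZMod l) := ⟨a, by push_cast at h0; linear_combination -h0⟩
  have := (ZMod.exists_sq_eq_two_iff (by omega)).1 this
  omega

lemma not_dvd_sq_add_two {l : ℕ} (hl : l.Prime) (h : l % 8 = 5 ∨ l % 8 = 7) (a : ℤ) :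
    ¬ (l : ℤ) ∣ a ^ 2 + 2 := by
  have : Fact l.Prime := ⟨hl⟩
  intro hd
  have h0 := (ZMod.intCast_zmod_eq_zero_iff_dvd _ l).2 hd
  have : IsSquare (-2 : ZMod l) := ⟨a, by push_cast at h0; linear_combination -h0⟩
  have := (ZMod.exists_sq_eq_neg_two_iff (by omega)).1 this
  omega

lemma not_dvd_sq_add_four {l : ℕ} (hl : l.Prime) (h : l % 4 = 3) (a : ℤ) :
    ¬ (l : ℤ) ∣ a ^ 2 + 4 := by
  have : Fact l.Prime := ⟨hl⟩
  intro hd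
  have h0 := (ZMod.intCast_zmod_eq_zero_iff_dvd _ l).2 hd
  have h2 : (2 : ZMod l) ≠ 0 := by
    intro h2
    have : l ∣ 2 := (ZMod.natCast_eq_zero_iff 2 l).1 (by exact_mod_cast h2)
    have := Nat.le_of_dvd two_pos this
    omega
  refine ZMod.mod_four_ne_three_of_sq_eq_neg_sq' (y := (2 : ZMod l)) (x := (a : ZMod l)) h2 ?_ h
  push_cast at h0
  linear_combination h0

/-- If `a e` and `b f` are squares in `K`, and so is `a b`, then `e f` is a square in `K`. -/
lemma exists_sq_eq_mul {K : IntermediateField ℚ ℝ} {a b : ℕ} {e f : ℝ} (ha : a ≠ 0) (hb : b ≠ 0)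
    (hab : √(a * b) ∈ K) (he : ∃ ξ ∈ K, ξ ^ 2 = a * e) (hf : ∃ ξ ∈ K, ξ ^ 2 = b * f) :
    ∃ ξ : ℝ, ξ ∈ K ∧ ξ ^ 2 = e * f := by
  obtain ⟨ξ, hξ, hξe⟩ := he
  obtain ⟨η, hη, hηf⟩ := hf
  have ha' : (a : ℝ) ≠ 0 := by exact_mod_cast ha
  have hb' : (b : ℝ) ≠ 0 := by exact_mod_cast hb
  refine ⟨ξ * η / √(a * b), K.div_mem (K.mul_mem hξ hη) hab, ?_⟩
  rw [div_pow, mul_pow, hξe, hηf, Real.sq_sqrt (by positivity)]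
  field_simp

lemma sqrt_mul_self_natCast_mem (K : IntermediateField ℚ ℝ) (a : ℕ) : √(a * a) ∈ K := by
  rw [Real.sqrt_mul_self (Nat.cast_nonneg a)]
  exact _root_.natCast_mem K a

/-- Let `p, q, s` be distinct primes with `p ≡ 5 (mod 8)`, `s ≡ 3 (mod 8)`,
`q ≡ 7 (mod 8)` and `(p/q) = (p/s) = (s/q) = -1`.  Then each of the products
`ε_{pq}·ε_{2pq}`, `ε_{ps}·ε_{2ps}`, `ε_{qs}·ε_{2qs}`, `ε_{pq}·ε_{ps}` and
`ε_{pq}·ε_{qs}` of fundamental units is a square in `L⁺ = ℚ(√2, √(pq), √(ps))`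
(viewed inside `ℝ`). -/
theorem statement_15 (p q s : ℕ) (hp : p.Prime) (hq : q.Prime) (hs : s.Prime)
    (hpq : p ≠ q) (hps : p ≠ s) (hqs : q ≠ s)
    (hp8 : p % 8 = 5) (hs8 : s % 8 = 3) (hq8 : q % 8 = 7)
    (hleg1 : @legendreSym q ⟨hq⟩ (p : ℤ) = -1)
    (hleg2 : @legendreSym s ⟨hs⟩ (p : ℤ) = -1)
    (hleg3 : @legendreSym q ⟨hq⟩ (s : ℤ) = -1)
    (epq e2pq eps e2ps eqs e2qs : ℝ)
    (hepq : IsFundamentalUnit (p * q) epq)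
    (he2pq : IsFundamentalUnit (2 * p * q) e2pq)
    (heps : IsFundamentalUnit (p * s) eps)
    (he2ps : IsFundamentalUnit (2 * p * s) e2ps)
    (heqs : IsFundamentalUnit (q * s) eqs)
    (he2qs : IsFundamentalUnit (2 * q * s) e2qs) :
    (∃ ξ : ℝ, ξ ∈ Lplus p q s ∧ ξ ^ 2 = epq * e2pq) ∧
    (∃ ξ : ℝ, ξ ∈ Lplus p q s ∧ ξ ^ 2 = eps * e2ps) ∧
    (∃ ξ : ℝ, ξ ∈ Lplus p q s ∧ ξ ^ 2 = eqs * e2qs) ∧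
    (∃ ξ : ℝ, ξ ∈ Lplus p q s ∧ ξ ^ 2 = epq * eps) ∧
    (∃ ξ : ℝ, ξ ∈ Lplus p q s ∧ ξ ^ 2 = epq * eqs) := by
  have hK2 : √2 ∈ Lplus p q s := subset_adjoin ℚ _ (by simp)
  have hKpq : √(p * q) ∈ Lplus p q s := subset_adjoin ℚ _ (by simp)
  have hKps : √(p * s) ∈ Lplus p q s := subset_adjoin ℚ _ (by simp)
  have hp0 : (p : ℝ) ≠ 0 := by exact_mod_cast hp.ne_zero
  have hKqs : √(q * s) ∈ Lplus p q s := by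
    have : √(q * s : ℝ) = √(p * q) * √(p * s) / p := by
      rw [← Real.sqrt_mul (by positivity), eq_div_iff hp0,
        show (p * q * (p * s) : ℝ) = q * s * (p * p) by ring,
        Real.sqrt_mul (x := (q * s : ℝ)) (by positivity),
        Real.sqrt_mul_self (Nat.cast_nonneg p)]
    rw [this]
    exact div_mem (mul_mem hKpq hKps) (_root_.natCast_mem _ p)
  have hl : ∀ a b : ℕ, (a : ℤ) ∣ ((a * b : ℕ) : ℤ) := fun a b => ⟨b, by push_cast; ring⟩
  have hr : ∀ a b : ℕ, (b : ℤ) ∣ ((a * b : ℕ) : ℤ) := fun a b => ⟨a, by push_cast; ring⟩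
  have Hpq : ∀ {d e}, d = p * q ∨ d = 2 * p * q → IsFundamentalUnit d e →
      ∃ ξ ∈ Lplus p q s, ξ ^ 2 = p * e := fun hd he =>
    exists_sq_eq_mul_fundamentalUnit hp hq hpq (by omega) (by omega) hd
      (fun a h => not_dvd_sq_sub_two hp (by omega) a ((hl p q).trans h))
      (fun a h => not_dvd_sq_add_two hp (by omega) a ((hl p q).trans h))
      (fun a h => not_dvd_sq_add_four hq (by omega) a ((hr p q).trans h)) _ hK2 hKpq he
  have Hps : ∀ {d e}, d = p * s ∨ d = 2 * p * s → IsFundamentalUnit d e →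
      ∃ ξ ∈ Lplus p q s, ξ ^ 2 = p * e := fun hd he =>
    exists_sq_eq_mul_fundamentalUnit hp hs hps (by omega) (by omega) hd
      (fun a h => not_dvd_sq_sub_two hp (by omega) a ((hl p s).trans h))
      (fun a h => not_dvd_sq_add_two hp (by omega) a ((hl p s).trans h))
      (fun a h => not_dvd_sq_add_four hs (by omega) a ((hr p s).trans h)) _ hK2 hKps he
  have Hqs : ∀ {d e}, d = q * s ∨ d = 2 * q * s → IsFundamentalUnit d e →
      ∃ ξ ∈ Lplus p q s, ξ ^ 2 = q * e := fun hd he =>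
    exists_sq_eq_mul_fundamentalUnit hq hs hqs (by omega) (by omega) hd
      (fun a h => not_dvd_sq_sub_two hs (by omega) a ((hr q s).trans h))
      (fun a h => not_dvd_sq_add_two hq (by omega) a ((hl q s).trans h))
      (fun a h => not_dvd_sq_add_four hq (by omega) a ((hl q s).trans h)) _ hK2 hKqs he
  have hpp := sqrt_mul_self_natCast_mem (Lplus p q s) p
  have hqq := sqrt_mul_self_natCast_mem (Lplus p q s) q
  have hp' := hp.ne_zero
  have hq' := hq.ne_zero
  exact ⟨exists_sq_eq_mul hp' hp' hpp (Hpq (.inl rfl) hepq) (Hpq (.inr rfl) he2pq),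
    exists_sq_eq_mul hp' hp' hpp (Hps (.inl rfl) heps) (Hps (.inr rfl) he2ps),
    exists_sq_eq_mul hq' hq' hqq (Hqs (.inl rfl) heqs) (Hqs (.inr rfl) he2qs),
    exists_sq_eq_mul hp' hp' hpp (Hpq (.inl rfl) hepq) (Hps (.inl rfl) heps),
    exists_sq_eq_mul hp' hq' hKpq (Hpq (.inl rfl) hepq) (Hqs (.inl rfl) heqs)⟩
end
end

section
/- Let p, q, s be distinct primes with p ≡ 5 (mod 8), s ≡ 3 (mod 8), q ≡ 7 (mod 8), and Legendre symbols (p/q) = (p/s) = (s/q) = −1. Then ε_{pq} is not a square in the real biquadratic field ℚ(√(pq), √(ps)) (viewing ε_{pq} as a real number and ℚ(√(pq), √(ps)) as a subfield of ℝ). -/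
open Real IntermediateField

noncomputable section

/-- If `x ^ 2` lies in `F`, adjoining elements of `F + F x` to `ℚ` stays in `F + F x`. -/
lemma exists_add_mul_of_mem_adjoin {F : IntermediateField ℚ ℝ} {x : ℝ} (hx : x ^ 2 ∈ F)
    {S : Set ℝ} (hS : ∀ y ∈ S, IsIntegral ℚ y)
    (hSF : ∀ y ∈ S, ∃ a ∈ F, ∃ b ∈ F, y = a + b * x) {y : ℝ} (hy : y ∈ adjoin ℚ S) :
    ∃ a ∈ F, ∃ b ∈ F, y = a + b * x := by
  rw [← IntermediateField.mem_toSubalgebra,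
    adjoin_toSubalgebra_of_isAlgebraic (fun y h => (hS y h).isAlgebraic)] at hy
  induction hy using Algebra.adjoin_induction with
  | mem y hy => exact hSF y hy
  | algebraMap r => exact ⟨_, F.algebraMap_mem r, 0, F.zero_mem, by simp⟩
  | add y z _ _ hy hz =>
    obtain ⟨a, ha, b, hb, rfl⟩ := hy
    obtain ⟨c, hc, e, he, rfl⟩ := hz
    exact ⟨a + c, F.add_mem ha hc, b + e, F.add_mem hb he, by ring⟩
  | mul y z _ _ hy hz =>
    obtain ⟨a, ha, b, hb, rfl⟩ := hy
    obtain ⟨c, hc, e, he, rfl⟩ := hz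
    exact ⟨a * c + b * e * x ^ 2,
      F.add_mem (F.mul_mem ha hc) (F.mul_mem (F.mul_mem hb he) hx),
      a * e + b * c, F.add_mem (F.mul_mem ha he) (F.mul_mem hb hc), by ring⟩

lemma isIntegral_sqrt_natCast (n : ℕ) : IsIntegral ℚ (√(n : ℝ)) := by
  refine IsIntegral.of_pow (n := 2) (by norm_num) ?_
  rw [Real.sq_sqrt (Nat.cast_nonneg n)]
  exact_mod_cast isIntegral_algebraMap (R := ℚ) (A := ℝ) (x := (n : ℚ))

lemma exists_rat_of_mem_adjoin_sqrt {n : ℕ} {y : ℝ}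
    (hy : y ∈ adjoin ℚ {√(n : ℝ)}) : ∃ u v : ℚ, y = u + v * √(n : ℝ) := by
  obtain ⟨a, ha, b, hb, rfl⟩ := exists_add_mul_of_mem_adjoin (F := ⊥) (x := √(n : ℝ))
    (by rw [Real.sq_sqrt (Nat.cast_nonneg n)]; exact _root_.natCast_mem _ n)
    (by rintro y rfl; exact isIntegral_sqrt_natCast n)
    (by rintro y rfl; exact ⟨0, zero_mem _, 1, one_mem _, by simp⟩) hy
  obtain ⟨u, rfl⟩ := IntermediateField.mem_bot.1 ha
  obtain ⟨v, rfl⟩ := IntermediateField.mem_bot.1 hb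
  exact ⟨u, v, by simp⟩

/-- A square root in `ℚ(√n, √m)` of an element of `ℚ(√n)` lies in `ℚ(√n)` or in `ℚ(√n) √m`. -/
lemma exists_rat_of_sq_mem {n m : ℕ} {y : ℝ} (hy : y ∈ adjoin ℚ {√(n : ℝ), √(m : ℝ)})
    (hsq : y ^ 2 ∈ adjoin ℚ {√(n : ℝ)}) :
    ∃ u v : ℚ, y = u + v * √(n : ℝ) ∨ y = (u + v * √(n : ℝ)) * √(m : ℝ) := by
  set F := adjoin ℚ {√(n : ℝ)}
  have hn : √(n : ℝ) ∈ F := mem_adjoin_simple_self ℚ _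
  have hm2 : √(m : ℝ) ^ 2 ∈ F := by
    rw [Real.sq_sqrt (Nat.cast_nonneg m)]; exact _root_.natCast_mem _ m
  obtain ⟨a, ha, b, hb, hab⟩ := exists_add_mul_of_mem_adjoin (F := F) (x := √(m : ℝ)) hm2
    (by rintro y (rfl | rfl) <;> exact isIntegral_sqrt_natCast _)
    (by
      rintro y (rfl | rfl)
      · exact ⟨_, hn, 0, zero_mem _, by simp⟩
      · exact ⟨0, zero_mem _, 1, one_mem _, by simp⟩) hy
  by_cases ha0 : a = 0
  · obtain ⟨u, v, huv⟩ := exists_rat_of_mem_adjoin_sqrt hb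
    exact ⟨u, v, Or.inr (by rw [hab, ha0, huv, zero_add])⟩
  have hyF : y ∈ F := by
    by_cases hb0 : b = 0
    · rw [hab, hb0]; simpa using ha
    have hm : √(m : ℝ) = (y ^ 2 - a ^ 2 - b ^ 2 * √(m : ℝ) ^ 2) / (2 * a * b) := by
      field_simp
      rw [hab]; ring
    have hmF : √(m : ℝ) ∈ F := by
      rw [hm]
      exact div_mem (sub_mem (sub_mem hsq (pow_mem ha 2)) (mul_mem (pow_mem hb 2) hm2))
        (mul_mem (mul_mem (ofNat_mem _ 2) ha) hb)
    rw [hab]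
    exact add_mem ha (mul_mem hb hmF)
  obtain ⟨u, v, huv⟩ := exists_rat_of_mem_adjoin_sqrt hyF
  exact ⟨u, v, Or.inl huv⟩

lemma exists_int_of_sq_eq_int {r : ℚ} {k : ℤ} (h : r ^ 2 = k) : ∃ m : ℤ, r = m := by
  obtain ⟨m, hm⟩ := IsIntegrallyClosed.exists_algebraMap_eq_of_isIntegral_pow (R := ℤ)
    (x := r) (n := 2) (by norm_num) (by rw [h]; exact isIntegral_algebraMap (x := k))
  exact ⟨m, by simpa using hm.symm⟩

lemma rat_coeff_eq_of_irrational {x : ℝ} (hx : Irrational x) {a b c e : ℚ}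
    (h : (a : ℝ) + b * x = c + e * x) : a = c ∧ b = e := by
  have hbe : b = e := by
    by_contra hne
    have hne' : (b : ℝ) - e ≠ 0 := sub_ne_zero.2 (by exact_mod_cast hne)
    refine hx ⟨(c - a) / (b - e), ?_⟩
    push_cast
    rw [div_eq_iff hne']
    linarith
  subst hbe
  exact ⟨by exact_mod_cast (add_right_cancel h), rfl⟩

lemma irrational_sqrt_of_mod_four {d : ℕ} (hd : d % 4 = 3) : Irrational (√(d : ℝ)) := by
  rw [irrational_sqrt_natCast_iff]
  rintro ⟨r, rfl⟩
  have : r % 4 < 4 := Nat.mod_lt _ (by norm_num)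
  rw [Nat.mul_mod] at hd
  interval_cases r % 4 <;> simp at hd

/-- If `d ≡ 3 (mod 4)` has a prime factor `≡ 3 (mod 4)`, each unit of `ℚ(√d)` has norm `1`
and lies in `ℤ[√d]`. -/
lemma IsQuadUnit.exists_int {d q : ℕ} (hd : d % 4 = 3) (hq : q.Prime) (hq4 : q % 4 = 3)
    (hqd : q ∣ d) {e : ℝ} (h : IsQuadUnit d e) :
    ∃ a b : ℤ, 1 ≤ a ∧ 1 ≤ b ∧ a ^ 2 - d * b ^ 2 = 1 ∧ e = a + b * √(d : ℝ) := by
  obtain ⟨x, y, hx, hy, hxy, he⟩ := h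
  have hpar : Even x ∧ Even y := by
    have hd' : (d : ℤ) % 4 = 3 := by omega
    have key : (x ^ 2 - (d : ℤ) * y ^ 2) % 4 = 0 := by rcases hxy with h | h <;> rw [h] <;> rfl
    rw [Int.sub_emod, Int.mul_emod, hd', pow_two, pow_two, Int.mul_emod x, Int.mul_emod y] at key
    rw [Int.even_iff, Int.even_iff]
    have h1 : x % 4 = 0 ∨ x % 4 = 1 ∨ x % 4 = 2 ∨ x % 4 = 3 := by omega
    have h2 : y % 4 = 0 ∨ y % 4 = 1 ∨ y % 4 = 2 ∨ y % 4 = 3 := by omega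
    rcases h1 with h1 | h1 | h1 | h1 <;> rcases h2 with h2 | h2 | h2 | h2 <;>
      rw [h1, h2] at key <;> omega
  obtain ⟨⟨a, rfl⟩, ⟨b, rfl⟩⟩ := hpar
  refine ⟨a, b, by omega, by omega, ?_, ?_⟩
  · rcases hxy with h | h
    · linarith
    · exfalso
      have : Fact q.Prime := ⟨hq⟩
      have hz : (a : ZMod q) ^ 2 = -1 := by
        have h1 : a ^ 2 - d * b ^ 2 = -1 := by linarith
        have h2 := congrArg (Int.cast : ℤ → ZMod q) h1
        have h3 : (d : ZMod q) = 0 := (ZMod.natCast_eq_zero_iff _ _).2 hqd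
        push_cast at h2
        simpa [h3] using h2
      exact ZMod.mod_four_ne_three_of_sq_eq_neg_one hz hq4
  · push_cast at he
    linarith

/-- The fundamental unit is not a square in its own quadratic field. -/
lemma IsFundamentalUnit.ne_sq {d : ℕ} (hd : Squarefree d) (hirr : Irrational (√(d : ℝ)))
    {e : ℝ} (he : IsFundamentalUnit d e) {a b : ℤ} (hb : 1 ≤ b)
    (hnorm : a ^ 2 - d * b ^ 2 = 1) (hab : e = a + b * √(d : ℝ)) (u v : ℚ) :
    (u + v * √(d : ℝ)) ^ 2 ≠ e := by
  intro h
  have hD : √(d : ℝ) ^ 2 = d := Real.sq_sqrt (Nat.cast_nonneg d)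
  have hd0 : (d : ℚ) ≠ 0 := by exact_mod_cast hd.ne_zero
  obtain ⟨h1, h2⟩ := rat_coeff_eq_of_irrational hirr (a := u ^ 2 + d * v ^ 2) (b := 2 * u * v)
    (c := a) (e := b) (by push_cast; rw [← hab, ← h]; linear_combination -(v : ℝ) ^ 2 * hD)
  have hnormQ : (a : ℚ) ^ 2 - d * b ^ 2 = 1 := by exact_mod_cast hnorm
  have hN : u ^ 2 - d * v ^ 2 = 1 ∨ u ^ 2 - d * v ^ 2 = -1 := by
    apply sq_eq_sq_iff_eq_or_eq_neg.1
    rw [one_pow, ← hnormQ, ← h1, ← h2]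
    ring
  obtain ⟨c, hc, hcN⟩ : ∃ c : ℤ, (c = 1 ∨ c = -1) ∧ u ^ 2 - d * v ^ 2 = c := by
    rcases hN with h | h
    · exact ⟨1, Or.inl rfl, by simpa using h⟩
    · exact ⟨-1, Or.inr rfl, by simpa using h⟩
  obtain ⟨k, hk⟩ := exists_int_of_sq_eq_int (r := 2 * u) (k := 2 * (a + c))
    (by push_cast; rw [← h1, ← hcN]; ring)
  have hkZ : k ^ 2 = 2 * (a + c) := by
    have : (k : ℚ) ^ 2 = 2 * (a + c) := by rw [← hk, ← h1, ← hcN]; ring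
    exact_mod_cast this
  obtain ⟨U, rfl⟩ : (2 : ℤ) ∣ k := Int.prime_two.dvd_of_dvd_pow ⟨_, hkZ⟩
  have hu : u = U := by push_cast at hk; linarith
  obtain ⟨w, hw⟩ := exists_int_of_sq_eq_int (r := d * v) (k := d * (U ^ 2 - c))
    (by push_cast; rw [← hcN, ← hu]; ring)
  have hwZ : w ^ 2 = d * (U ^ 2 - c) := by
    have : (w : ℚ) ^ 2 = d * (U ^ 2 - c) := by rw [← hw, ← hcN, ← hu]; ring
    exact_mod_cast this
  obtain ⟨V, rfl⟩ : (d : ℤ) ∣ w :=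
    ((Int.squarefree_natCast.2 hd).dvd_pow_iff_dvd two_ne_zero).1 ⟨_, hwZ⟩
  have hv : v = V := by push_cast at hw; exact mul_left_cancel₀ hd0 hw
  subst hu hv
  have h2Z : 2 * U * V = b := by exact_mod_cast h2
  have hcZ : U ^ 2 - d * V ^ 2 = c := by exact_mod_cast hcN
  have hU : U ≠ 0 := by rintro rfl; simp at h2Z; omega
  have hV : V ≠ 0 := by rintro rfl; simp at h2Z; omega
  have hU1 : 1 ≤ |U| := Int.one_le_abs hU
  have hV1 : 1 ≤ |V| := Int.one_le_abs hV
  set η : ℝ := (|U| : ℤ) + (|V| : ℤ) * √(d : ℝ) with hη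
  have hle := he.2 η ⟨2 * |U|, 2 * |V|, by omega, by omega, by
    rw [mul_pow, mul_pow, sq_abs, sq_abs]
    rcases hc with rfl | rfl
    · left; linarith
    · right; linarith, by rw [hη]; push_cast; ring⟩
  have hUV : |U| * |V| = U * V := by
    rw [← abs_mul, abs_of_nonneg]; nlinarith
  have hUVR : ((|U| : ℤ) : ℝ) * (|V| : ℤ) = U * V := by exact_mod_cast hUV
  have hUR : ((|U| : ℤ) : ℝ) ^ 2 = U ^ 2 := by exact_mod_cast sq_abs U
  have hVR : ((|V| : ℤ) : ℝ) ^ 2 = V ^ 2 := by exact_mod_cast sq_abs V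
  have hηe : η ^ 2 = e := by
    rw [← h, hη]; push_cast at *
    linear_combination hUR + √(d : ℝ) ^ 2 * hVR + 2 * √(d : ℝ) * hUVR
  have hη1 : 1 < η := by
    have hUr : (1 : ℝ) ≤ (|U| : ℤ) := by exact_mod_cast hU1
    have hVr : (1 : ℝ) ≤ (|V| : ℤ) := by exact_mod_cast hV1
    have : 0 < √(d : ℝ) := Real.sqrt_pos.2 (by exact_mod_cast hd.ne_zero.bot_lt)
    rw [hη]; nlinarith
  nlinarith

/-- If a prime `s ≠ 2` divides `m` exactly once and does not divide `d`, then `m` times a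
square of `ℚ(√d)` is not a norm-one element of `ℤ[√d]`. -/
lemma sq_mul_ne_of_prime_dvd {d m s : ℕ} (hs : s.Prime) (hs2 : s ≠ 2) (hsm : s ∣ m)
    (hsm2 : ¬ s ^ 2 ∣ m) (hsd : ¬ s ∣ d) (hirr : Irrational (√(d : ℝ))) {a b : ℤ}
    (hnorm : a ^ 2 - d * b ^ 2 = 1) (u v : ℚ) :
    (u + v * √(d : ℝ)) ^ 2 * m ≠ a + b * √(d : ℝ) := by
  intro h
  have hD : √(d : ℝ) ^ 2 = d := Real.sq_sqrt (Nat.cast_nonneg d)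
  obtain ⟨h1, h2⟩ := rat_coeff_eq_of_irrational hirr (a := m * (u ^ 2 + d * v ^ 2))
    (b := m * (2 * u * v)) (c := a) (e := b)
    (by push_cast; rw [← h]; linear_combination -m * (v : ℝ) ^ 2 * hD)
  have hnormQ : (a : ℚ) ^ 2 - d * b ^ 2 = 1 := by exact_mod_cast hnorm
  have hN : m * (u ^ 2 - d * v ^ 2) = 1 ∨ m * (u ^ 2 - d * v ^ 2) = -1 := by
    apply sq_eq_sq_iff_eq_or_eq_neg.1
    rw [one_pow, ← hnormQ, ← h1, ← h2]
    ring
  obtain ⟨c, hc, hcN⟩ : ∃ c : ℤ, (c = 1 ∨ c = -1) ∧ m * (u ^ 2 - d * v ^ 2) = c := by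
    rcases hN with h | h
    · exact ⟨1, Or.inl rfl, by simpa using h⟩
    · exact ⟨-1, Or.inr rfl, by simpa using h⟩
  obtain ⟨t, rfl⟩ := hsm
  have hst : ¬ (s : ℤ) ∣ t := by
    rw [Int.natCast_dvd_natCast]
    rintro ⟨w, rfl⟩
    exact hsm2 ⟨w, by ring⟩
  have hsd' : ¬ (s : ℤ) ∣ d := by rwa [Int.natCast_dvd_natCast]
  have hsP : Prime (s : ℤ) := Nat.prime_iff_prime_int.1 hs
  have hs2' : ¬ (s : ℤ) ∣ 2 := by
    intro h
    exact hs2 ((Nat.prime_dvd_prime_iff_eq hs Nat.prime_two).1 (by exact_mod_cast h))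
  have key : ∀ (r : ℚ) (f g : ℤ), ¬ (s : ℤ) ∣ f → r ^ 2 = (s * f * g : ℤ) → (s : ℤ) ∣ g := by
    intro r f g hf hr
    obtain ⟨k, rfl⟩ := exists_int_of_sq_eq_int hr
    have hk : k ^ 2 = s * f * g := by exact_mod_cast hr
    obtain ⟨w, rfl⟩ : (s : ℤ) ∣ k := hsP.dvd_of_dvd_pow ⟨f * g, by rw [hk]; ring⟩
    have : f * g = s * w ^ 2 := mul_left_cancel₀ hsP.ne_zero (by rw [← mul_assoc, ← hk]; ring)
    exact (hsP.dvd_or_dvd ⟨_, this⟩).resolve_left hf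
  have hplus : (s : ℤ) ∣ a + c := key (2 * (s * t : ℕ) * u) (2 * t) _
    (fun h => (hsP.dvd_or_dvd h).elim hs2' hst)
    (by push_cast at *; rw [← h1, ← hcN]; ring)
  have hminus : (s : ℤ) ∣ a - c := key (2 * (s * t : ℕ) * d * v) (2 * t * d) _
    (fun h => (hsP.dvd_or_dvd h).elim (fun h => (hsP.dvd_or_dvd h).elim hs2' hst) hsd')
    (by push_cast at *; rw [← h1, ← hcN]; ring)
  have h2c : (s : ℤ) ∣ 2 * c := by
    have := dvd_sub hplus hminus
    rwa [show a + c - (a - c) = 2 * c by ring] at this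
  rcases hc with rfl | rfl
  · exact hs2' (by simpa using h2c)
  · exact hs2' (by simpa using h2c)

/-- Let `p, q, s` be distinct primes with `p ≡ 5 (mod 8)`, `s ≡ 3 (mod 8)`,
`q ≡ 7 (mod 8)` and `(p/q) = (p/s) = (s/q) = -1`.  Then the fundamental unit
`ε_{pq}` is not a square in the real biquadratic field `ℚ(√(pq), √(ps))`
(viewed inside `ℝ`). -/
theorem statement_18 (p q s : ℕ) (hp : p.Prime) (hq : q.Prime) (hs : s.Prime)
    (hpq : p ≠ q) (hps : p ≠ s) (hqs : q ≠ s)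
    (hp8 : p % 8 = 5) (hs8 : s % 8 = 3) (hq8 : q % 8 = 7)
    (hleg1 : @legendreSym q ⟨hq⟩ (p : ℤ) = -1)
    (hleg2 : @legendreSym s ⟨hs⟩ (p : ℤ) = -1)
    (hleg3 : @legendreSym q ⟨hq⟩ (s : ℤ) = -1)
    (epq : ℝ) (hepq : IsFundamentalUnit (p * q) epq) :
    ¬ ∃ ξ : ℝ, ξ ∈ (adjoin ℚ {Real.sqrt (p * q), Real.sqrt (p * s)} :
        IntermediateField ℚ ℝ) ∧ ξ ^ 2 = epq := by
  rintro ⟨ξ, hξ, hsq⟩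
  rw [← Nat.cast_mul, ← Nat.cast_mul] at hξ
  have hd4 : (p * q) % 4 = 3 := by
    rw [Nat.mul_mod, show p % 4 = 1 by omega, show q % 4 = 3 by omega]
  have hirr := irrational_sqrt_of_mod_four hd4
  have hcop : ∀ {x y : ℕ}, x.Prime → y.Prime → x ≠ y → ¬ x ∣ y :=
    fun hx hy hne h => hne ((Nat.prime_dvd_prime_iff_eq hx hy).1 h)
  have hd : Squarefree (p * q) := (Nat.squarefree_mul ((Nat.coprime_primes hp hq).2 hpq)).2
    ⟨hp.prime.squarefree, hq.prime.squarefree⟩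
  obtain ⟨a, b, -, hb, hnorm, hab⟩ :=
    hepq.1.exists_int hd4 hq (by omega) (Dvd.intro_left p rfl)
  obtain ⟨u, v, rfl | rfl⟩ := exists_rat_of_sq_mem hξ (by
    rw [hsq, hab]
    exact add_mem (intCast_mem _ a) (mul_mem (intCast_mem _ b) (mem_adjoin_simple_self ℚ _)))
  · exact hepq.ne_sq hd hirr hb hnorm hab u v hsq
  · refine sq_mul_ne_of_prime_dvd (m := p * s) hs (by omega) (Dvd.intro_left p rfl) ?_ ?_ hirr
      hnorm u v ?_
    · rw [pow_two, Nat.mul_dvd_mul_iff_right hs.pos]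
      exact hcop hs hp hps.symm
    · rw [hs.dvd_mul]
      exact not_or.2 ⟨hcop hs hp hps.symm, hcop hs hq hqs.symm⟩
    · rw [← hab, ← hsq, mul_pow, Real.sq_sqrt (Nat.cast_nonneg _)]
end
end
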